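/- Assume P is irreducible and μ(k) > 0 for every k ∈ D. Then for every i ∈ D, σ_i² ≤ u(i)² · ∑_{k∈D} ∑_{ℓ∈[n], ℓ≠k} (∑_{t=1}^{τ} S^t(k,ℓ)) / (μ(k)·Q^τ(k,ℓ)²), where the right-hand side is evaluated in [0,+∞] with the conventions a/0 = +∞ for a > 0 and 0/0 = 0. -/

import Mathlib

open MeasureTheory Finset Filter
open scoped ENNReal NNReal ENat

noncomputable section

namespace RareTD

variable {n : ℕ}

/-- `P` is a row-stochastic matrix. -/
def IsStochastic (P : Matrix (Fin n) (Fin n) ℝ) : Prop :=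
  (∀ i j, 0 ≤ P i j) ∧ ∀ i, ∑ j, P i j = 1

/-- Irreducibility of a nonnegative matrix. -/
def IsIrreducible (P : Matrix (Fin n) (Fin n) ℝ) : Prop :=
  ∀ i j, ∃ m : ℕ, 0 < m ∧ 0 < (P ^ m) i j

/-- `Pr i` is the law of the Markov chain with transition matrix `P` started at `i`,
characterized by its finite-dimensional distributions. -/
def IsMarkovFamily (P : Matrix (Fin n) (Fin n) ℝ)
    (Pr : Fin n → Measure (ℕ → Fin n)) : Prop :=
  (∀ i, IsProbabilityMeasure (Pr i)) ∧
    ∀ (i : Fin n) (m : ℕ) (x : ℕ → Fin n),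
      (Pr i {ω | ∀ t ≤ m, ω t = x t}).toReal =
        (if x 0 = i then 1 else 0) * ∏ t ∈ Finset.range m, P (x t) (x (t + 1))

/-- The matrix `S` of the chain stopped on exiting `D`. -/
def stopMat (P : Matrix (Fin n) (Fin n) ℝ) (D : Finset (Fin n)) :
    Matrix (Fin n) (Fin n) ℝ :=
  fun i j => if i ∈ D then P i j else if i = j then 1 else 0

/-- Exit time `T = min {t ≥ 0 : ω t ∉ D}`, with value `⊤` if the path never leaves `D`. -/
def exitT (D : Finset (Fin n)) (ω : ℕ → Fin n) : ℕ∞ :=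
  ⨅ (t : ℕ) (_ : ω t ∉ D), (t : ℕ∞)

/-- Hitting time of a set at positive times, `min {t > 0 : ω t ∈ A}`. -/
def hitT (A : Set (Fin n)) (ω : ℕ → Fin n) : ℕ∞ :=
  ⨅ (t : ℕ) (_ : 0 < t ∧ ω t ∈ A), (t : ℕ∞)

/-- The stopped path `t ↦ X_{t ∧ T}`. -/
def stopped (D : Finset (Fin n)) (ω : ℕ → Fin n) : ℕ → Fin n
  | 0 => ω 0
  | t + 1 => if stopped D ω t ∈ D then ω (t + 1) else stopped D ω t

/-- `R_D`, the reward restricted to `D`. -/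
def RD (D : Finset (Fin n)) (R : Fin n → ℝ) : Fin n → ℝ := fun i => if i ∈ D then R i else 0

/-- The value function `u(i) = E_i[∑_{t=0}^{T} R(X_t)]`, in `[0,∞]`. -/
def valueE (Pr : Fin n → Measure (ℕ → Fin n)) (D : Finset (Fin n)) (R : Fin n → ℝ)
    (i : Fin n) : ℝ≥0∞ :=
  ∑' t : ℕ, ∫⁻ ω, Set.indicator {ω' : ℕ → Fin n | (t : ℕ∞) ≤ exitT D ω'}
      (fun ω' => ENNReal.ofReal (R (ω' t))) ω ∂(Pr i)

/-- The real-valued value function. -/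
def valueR (Pr : Fin n → Measure (ℕ → Fin n)) (D : Finset (Fin n)) (R : Fin n → ℝ)
    (i : Fin n) : ℝ := (valueE Pr D R i).toReal

/-- Replace by `0` every row and column with index outside `D`. -/
def zeroD (D : Finset (Fin n)) (M : Matrix (Fin n) (Fin n) ℝ) : Matrix (Fin n) (Fin n) ℝ :=
  fun i j => if i ∈ D ∧ j ∈ D then M i j else 0

/-- The asymptotic variance `σ_i²` of the LSTD estimator. -/
def avar (P : Matrix (Fin n) (Fin n) ℝ) (Pr : Fin n → Measure (ℕ → Fin n))
    (D : Finset (Fin n)) (R : Fin n → ℝ) (μ : Fin n → ℝ) (τ : ℕ) (i : Fin n) : ℝ :=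
  ∑ k ∈ D, (μ k)⁻¹ * ((((1 : Matrix (Fin n) (Fin n) ℝ) - zeroD D (stopMat P D ^ τ))⁻¹) i k) ^ 2 *
    ∫ ω, (∑ t ∈ Finset.range τ, RD D R (stopped D ω t)
        + valueR Pr D R (stopped D ω τ) - valueR Pr D R k) ^ 2 ∂(Pr k)

/-- Mean exit time `E_i[T] = ∑_{t≥0} P_i[T > t]`, in `[0,∞]`. -/
def meanExit (Pr : Fin n → Measure (ℕ → Fin n)) (D : Finset (Fin n)) (i : Fin n) : ℝ≥0∞ :=
  ∑' t : ℕ, Pr i {ω | (t : ℕ∞) < exitT D ω}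

/-- The event `T_ℓ^τ < min (T_k^τ, T_{Dᶜ∖{ℓ}}^τ)` for the `τ`-step chain. -/
def Qset (D : Finset (Fin n)) (k ℓ : Fin n) : Set (ℕ → Fin n) :=
  {ω | hitT {ℓ} ω < min (hitT {k} ω) (hitT ((D : Set (Fin n))ᶜ \ {ℓ}) ω)}

/-- Green's function of the `τ`-step chain: `E_i[∑_{t=0}^{T^τ-1} 1{Y_t^τ = k}]`. -/
def greenY (PrY : Fin n → Measure (ℕ → Fin n)) (D : Finset (Fin n)) (i k : Fin n) : ℝ≥0∞ :=
  ∑' t : ℕ, PrY i {ω | (t : ℕ∞) < exitT D ω ∧ ω t = k}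

/-- Green's function of the chain: `E_ℓ[∑_{t=0}^{T} 1{X_t = j}]` (the sum includes `t = T`). -/
def greenX (Pr : Fin n → Measure (ℕ → Fin n)) (D : Finset (Fin n)) (ℓ j : Fin n) : ℝ≥0∞ :=
  ∑' t : ℕ, Pr ℓ {ω | (t : ℕ∞) ≤ exitT D ω ∧ ω t = j}


/-! ### Strictly subinvariant vectors and nonnegative inverses -/

/-- `h` is a positive vector which the nonnegative matrix `A` strictly decreases. -/
structure IsContractive (A : Matrix (Fin n) (Fin n) ℝ) (h : Fin n → ℝ) : Prop where
  nonneg : ∀ i j, 0 ≤ A i j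
  pos : ∀ i, 0 < h i
  lt : ∀ i, (A.mulVec h) i < h i

theorem mulVec_le_mulVec {A : Matrix (Fin n) (Fin n) ℝ} (hA : ∀ i j, 0 ≤ A i j)
    {v w : Fin n → ℝ} (hvw : ∀ i, v i ≤ w i) (i : Fin n) : A.mulVec v i ≤ A.mulVec w i := by
  simp only [Matrix.mulVec, dotProduct]
  exact Finset.sum_le_sum fun j _ => mul_le_mul_of_nonneg_left (hvw j) (hA i j)

theorem mulVec_apply_nonneg {A : Matrix (Fin n) (Fin n) ℝ} (hA : ∀ i j, 0 ≤ A i j)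
    {v : Fin n → ℝ} (hv : ∀ i, 0 ≤ v i) (i : Fin n) : 0 ≤ A.mulVec v i := by
  simp only [Matrix.mulVec, dotProduct]
  exact Finset.sum_nonneg fun j _ => mul_nonneg (hA i j) (hv j)

theorem pow_apply_nonneg {A : Matrix (Fin n) (Fin n) ℝ} (hA : ∀ i j, 0 ≤ A i j) (m : ℕ)
    (i j : Fin n) : 0 ≤ (A ^ m) i j := by
  induction m generalizing i j with
  | zero =>
    rw [pow_zero, Matrix.one_apply]
    split_ifs <;> norm_num
  | succ m ih =>
    rw [pow_succ, Matrix.mul_apply]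
    exact Finset.sum_nonneg fun l _ => mul_nonneg (ih i l) (hA l j)

/-- Minimum principle. -/
theorem IsContractive.nonneg_of_mulVec_le {A : Matrix (Fin n) (Fin n) ℝ} {h : Fin n → ℝ}
    (hA : IsContractive A h) {v : Fin n → ℝ}
    (hv : ∀ i, v i < 0 → A.mulVec v i ≤ v i) (i : Fin n) :
    0 ≤ v i := by
  by_contra! hi
  have : Nonempty (Fin n) := ⟨i⟩
  obtain ⟨a, ha⟩ := Finite.exists_min fun j => v j / h j
  have hneg : v a / h a < 0 := (ha i).trans_lt (div_neg_of_neg_of_pos hi (hA.pos i))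
  have hva : v a = v a / h a * h a := (div_mul_cancel₀ _ (hA.pos a).ne').symm
  have hva' : v a < 0 := by
    rw [hva]
    exact mul_neg_of_neg_of_pos hneg (hA.pos a)
  have h1 : A.mulVec (fun j => v a / h a * h j) a ≤ A.mulVec v a :=
    mulVec_le_mulVec hA.nonneg (fun j => (le_div_iff₀ (hA.pos j)).1 (ha j)) a
  have h2 : A.mulVec (fun j => v a / h a * h j) a = v a / h a * A.mulVec h a := by
    simp only [Matrix.mulVec, dotProduct, Finset.mul_sum]
    exact Finset.sum_congr rfl fun j _ => by ring
  have h3 := mul_lt_mul_of_neg_left (hA.lt a) hneg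
  have h4 := hv a hva'
  linarith

theorem IsContractive.isUnit_det {A : Matrix (Fin n) (Fin n) ℝ} {h : Fin n → ℝ}
    (hA : IsContractive A h) : IsUnit (1 - A).det := by
  rw [isUnit_iff_ne_zero, Ne, ← Matrix.exists_mulVec_eq_zero_iff]
  rintro ⟨v, hv, hv0⟩
  rw [Matrix.sub_mulVec, Matrix.one_mulVec, sub_eq_zero] at hv0
  refine hv (funext fun i => le_antisymm ?_ ?_)
  · have := hA.nonneg_of_mulVec_le (v := -v) (fun i _ => by rw [Matrix.mulVec_neg, ← hv0]) i
    simpa using this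
  · exact hA.nonneg_of_mulVec_le (fun i _ => by rw [← hv0]) i

theorem IsContractive.inv_eq {A : Matrix (Fin n) (Fin n) ℝ} {h : Fin n → ℝ}
    (hA : IsContractive A h) : (1 - A)⁻¹ = 1 + A * (1 - A)⁻¹ := by
  have := Matrix.mul_nonsing_inv _ hA.isUnit_det
  rw [sub_mul, one_mul] at this
  exact sub_eq_iff_eq_add.1 this

theorem IsContractive.inv_nonneg {A : Matrix (Fin n) (Fin n) ℝ} {h : Fin n → ℝ}
    (hA : IsContractive A h) (i k : Fin n) : 0 ≤ (1 - A)⁻¹ i k := by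
  refine hA.nonneg_of_mulVec_le (v := fun j => (1 - A)⁻¹ j k) (fun j _ => ?_) i
  have h1 : (1 - A)⁻¹ j k = (1 : Matrix (Fin n) (Fin n) ℝ) j k + (A * (1 - A)⁻¹) j k :=
    congrFun (congrFun hA.inv_eq j) k
  have h2 : A.mulVec (fun j => (1 - A)⁻¹ j k) j = (A * (1 - A)⁻¹) j k := rfl
  have h3 : 0 ≤ (1 : Matrix (Fin n) (Fin n) ℝ) j k := by
    rw [Matrix.one_apply]
    split_ifs <;> norm_num
  linarith

/-! ### Potential theory of a chain killed outside `D` -/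

section Potential

variable {M : Matrix (Fin n) (Fin n) ℝ} {D : Finset (Fin n)} {h : Fin n → ℝ}

/-- The Green kernel of the chain with transition matrix `M` killed outside `D`. -/
def green (M : Matrix (Fin n) (Fin n) ℝ) (D : Finset (Fin n)) : Matrix (Fin n) (Fin n) ℝ :=
  ((1 : Matrix (Fin n) (Fin n) ℝ) - zeroD D M)⁻¹

theorem green_apply (hc : IsContractive (zeroD D M) h) (x k : Fin n) :
    green M D x k = (if x = k then 1 else 0) +
      if x ∈ D then ∑ y ∈ D, M x y * green M D y k else 0 := by
  have h1 : green M D x k = (1 : Matrix (Fin n) (Fin n) ℝ) x k + (zeroD D M * green M D) x k :=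
    congrFun (congrFun hc.inv_eq x) k
  rw [h1, Matrix.one_apply, Matrix.mul_apply]
  congr 1
  split_ifs with hx
  · rw [← Finset.sum_subset (Finset.subset_univ D)]
    · exact Finset.sum_congr rfl fun y hy => by simp [zeroD, hx, hy]
    · intro y _ hy
      simp [zeroD, hy]
  · exact Finset.sum_eq_zero fun y _ => by simp [zeroD, hx]

theorem green_nonneg (hc : IsContractive (zeroD D M) h) (x k : Fin n) : 0 ≤ green M D x k :=
  hc.inv_nonneg x k

theorem one_le_green_self (hM : ∀ i j, 0 ≤ M i j) (hc : IsContractive (zeroD D M) h)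
    (k : Fin n) : 1 ≤ green M D k k := by
  have h1 := green_apply hc k k
  have h2 : 0 ≤ if k ∈ D then ∑ y ∈ D, M k y * green M D y k else 0 := by
    split_ifs
    · exact Finset.sum_nonneg fun y _ => mul_nonneg (hM k y) (green_nonneg hc y k)
    · rfl
  rw [if_pos rfl] at h1
  linarith

/-- The probability of hitting `k` before leaving `D`. -/
def hitProb (M : Matrix (Fin n) (Fin n) ℝ) (D : Finset (Fin n)) (k x : Fin n) : ℝ :=
  green M D x k / green M D k k

theorem hitProb_nonneg (hc : IsContractive (zeroD D M) h) (k x : Fin n) :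
    0 ≤ hitProb M D k x :=
  div_nonneg (green_nonneg hc x k) (green_nonneg hc k k)

theorem hitProb_self (hM : ∀ i j, 0 ≤ M i j) (hc : IsContractive (zeroD D M) h) (k : Fin n) :
    hitProb M D k k = 1 :=
  div_self (by linarith [one_le_green_self hM hc k])

theorem hitProb_of_notMem (hc : IsContractive (zeroD D M) h) {k x : Fin n} (hk : k ∈ D)
    (hx : x ∉ D) : hitProb M D k x = 0 := by
  rw [hitProb, green_apply hc, if_neg hx, if_neg (ne_of_mem_of_not_mem hk hx).symm]
  simp

theorem mulVec_hitProb (hc : IsContractive (zeroD D M) h) {k x : Fin n} (hk : k ∈ D)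
    (hx : x ∈ D) :
    M.mulVec (hitProb M D k) x =
      hitProb M D k x - if x = k then (green M D k k)⁻¹ else 0 := by
  have h1 : M.mulVec (hitProb M D k) x
      = (∑ y ∈ D, M x y * green M D y k) * (green M D k k)⁻¹ := by
    rw [Matrix.mulVec, dotProduct, ← Finset.sum_subset (Finset.subset_univ D), Finset.sum_mul]
    · exact Finset.sum_congr rfl fun y _ => by rw [hitProb]; ring
    · intro y _ hy
      rw [hitProb_of_notMem hc hk hy, mul_zero]
  have h2 := green_apply hc x k
  rw [if_pos hx] at h2
  rw [h1, hitProb, h2]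
  split_ifs <;> ring

theorem mulVec_sub_hitProb (v : Fin n → ℝ) (k x : Fin n) :
    M.mulVec (fun y => v y - v k * hitProb M D k y) x =
      M.mulVec v x - v k * M.mulVec (hitProb M D k) x := by
  simp only [Matrix.mulVec, dotProduct, Finset.mul_sum, ← Finset.sum_sub_distrib]
  exact Finset.sum_congr rfl fun y _ => by ring

theorem mul_hitProb_le (hM : ∀ i j, 0 ≤ M i j) (hc : IsContractive (zeroD D M) h)
    {v : Fin n → ℝ} (hv : ∀ x, 0 ≤ v x) (hMv : ∀ x ∈ D, M.mulVec v x ≤ v x) {k : Fin n}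
    (hk : k ∈ D) (x : Fin n) : v k * hitProb M D k x ≤ v x := by
  set w : Fin n → ℝ := fun y => v y - v k * hitProb M D k y with hw
  have hwD : ∀ y ∉ D, 0 ≤ w y := fun y hy => by
    simpa [hw, hitProb_of_notMem hc hk hy] using hv y
  have hwk : w k = 0 := by simp [hw, hitProb_self hM hc]
  have key : 0 ≤ min (w x) 0 := by
    refine hc.nonneg_of_mulVec_le (v := fun y => min (w y) 0) (fun y hy => ?_) x
    have hwy : w y < 0 := by
      by_contra! h0
      simp [h0] at hy
    have hyD : y ∈ D := by
      by_contra h0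
      exact (hwD y h0).not_gt hwy
    have hyk : y ≠ k := fun e => by
      rw [e, hwk] at hwy
      exact lt_irrefl _ hwy
    have h1 : (zeroD D M).mulVec (fun y => min (w y) 0) y ≤ M.mulVec w y := by
      simp only [Matrix.mulVec, dotProduct]
      refine Finset.sum_le_sum fun z _ => ?_
      by_cases hz : z ∈ D
      · simp only [zeroD, hyD, hz, and_self, if_true]
        exact mul_le_mul_of_nonneg_left (min_le_left _ _) (hM y z)
      · simp only [zeroD, hz, and_false, if_false, zero_mul]
        exact mul_nonneg (hM y z) (hwD z hz)
    have h2 := mulVec_sub_hitProb (M := M) (D := D) v k y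
    rw [mulVec_hitProb hc hk hyD, if_neg hyk, sub_zero] at h2
    have h3 := hMv y hyD
    rw [min_eq_left hwy.le]
    change M.mulVec w y = _ at h2
    have h4 : w y = v y - v k * hitProb M D k y := rfl
    linarith
  have h5 := (le_min_iff.1 key).1
  simp only [hw] at h5
  linarith

/-- `q` is dominated by the probability, starting from `k`, of hitting `ℓ` before returning to `k`
and before visiting another point outside `D`. -/
def IsEscapeBound (M : Matrix (Fin n) (Fin n) ℝ) (D : Finset (Fin n)) (k ℓ : Fin n)
    (q : ℝ) : Prop :=
  ∀ w : Fin n → ℝ, (∀ x, 0 ≤ w x) → (∀ x ∈ D, x ≠ k → x ≠ ℓ → M.mulVec w x ≤ w x) →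
    q * w ℓ ≤ M.mulVec w k

theorem IsEscapeBound.mul_sub_le {k ℓ : Fin n} {q : ℝ} (hq : IsEscapeBound M D k ℓ q)
    (hM : ∀ i j, 0 ≤ M i j) (hc : IsContractive (zeroD D M) h)
    {v : Fin n → ℝ} (hv : ∀ x, 0 ≤ v x) (hMv : ∀ x ∈ D, M.mulVec v x ≤ v x) (hk : k ∈ D) :
    q * (v ℓ - v k * hitProb M D k ℓ) ≤ v k * (green M D k k)⁻¹ := by
  refine (hq (fun y => v y - v k * hitProb M D k y)
    (fun x => sub_nonneg.2 (mul_hitProb_le hM hc hv hMv hk x)) fun x hx hxk _ => ?_).trans ?_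
  · rw [mulVec_sub_hitProb, mulVec_hitProb hc hk hx, if_neg hxk, sub_zero]
    linarith [hMv x hx]
  · rw [mulVec_sub_hitProb, mulVec_hitProb hc hk hk, if_pos rfl, hitProb_self hM hc]
    linarith [hMv k hk]

theorem IsEscapeBound.green_mul_le {k ℓ : Fin n} {q : ℝ} (hq : IsEscapeBound M D k ℓ q)
    (hq0 : 0 ≤ q) (hM : IsStochastic M) (hc : IsContractive (zeroD D M) h)
    {u : Fin n → ℝ} (hu : ∀ x, 0 ≤ u x) (hMu : ∀ x ∈ D, M.mulVec u x ≤ u x) (hk : k ∈ D)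
    (i : Fin n) : green M D i k * |u ℓ - u k| * q ≤ u i := by
  have hone : ∀ x ∈ D, M.mulVec (fun _ => (1 : ℝ)) x ≤ 1 := fun x _ => by
    simp [Matrix.mulVec, dotProduct, hM.2 x]
  have h1 := hq.mul_sub_le hM.1 hc hu hMu hk
  have h2 := hq.mul_sub_le hM.1 hc (fun _ => zero_le_one) hone hk
  have h3 := mul_hitProb_le hM.1 hc (fun _ => zero_le_one) hone hk ℓ
  have h4 := hitProb_nonneg hc k ℓ
  have key : q * |u ℓ - u k| ≤ u k * (green M D k k)⁻¹ := by
    rcases le_total (u k) (u ℓ) with h5 | h5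
    · rw [abs_of_nonneg (by linarith)]
      refine le_trans (mul_le_mul_of_nonneg_left ?_ hq0) h1
      nlinarith [hu k]
    · rw [abs_of_nonpos (by linarith)]
      have h6 := mul_hitProb_le hM.1 hc hu hMu hk ℓ
      calc q * -(u ℓ - u k) ≤ q * (u k * (1 - 1 * hitProb M D k ℓ)) :=
            mul_le_mul_of_nonneg_left (by linarith) hq0
        _ = u k * (q * (1 - 1 * hitProb M D k ℓ)) := by ring
        _ ≤ u k * (1 * (green M D k k)⁻¹) := mul_le_mul_of_nonneg_left h2 (hu k)
        _ = _ := by ring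
  calc green M D i k * |u ℓ - u k| * q = green M D i k * (q * |u ℓ - u k|) := by ring
    _ ≤ green M D i k * (u k * (green M D k k)⁻¹) :=
        mul_le_mul_of_nonneg_left key (green_nonneg hc i k)
    _ = u k * hitProb M D k i := by rw [hitProb]; ring
    _ ≤ u i := mul_hitProb_le hM.1 hc hu hMu hk i

end Potential

/-! ### Stopped and killed transition matrices -/

theorem IsStochastic.pow {M : Matrix (Fin n) (Fin n) ℝ} (hM : IsStochastic M) (m : ℕ) :
    IsStochastic (M ^ m) := by
  refine ⟨pow_apply_nonneg hM.1 m, ?_⟩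
  induction m with
  | zero => simp [Matrix.one_apply]
  | succ m ih =>
    intro i
    simp only [pow_succ, Matrix.mul_apply]
    rw [Finset.sum_comm]
    simp [← Finset.mul_sum, hM.2, ih]

theorem IsStochastic.stopMat {P : Matrix (Fin n) (Fin n) ℝ} (hP : IsStochastic P)
    (D : Finset (Fin n)) : IsStochastic (stopMat P D) := by
  refine ⟨fun i j => ?_, fun i => ?_⟩
  · unfold RareTD.stopMat
    split_ifs
    exacts [hP.1 i j, zero_le_one, le_rfl]
  · by_cases hi : i ∈ D <;> simp [RareTD.stopMat, hi, hP.2]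

/-- The transition matrix of the chain killed after leaving `D`. -/
def killMat (P : Matrix (Fin n) (Fin n) ℝ) (D : Finset (Fin n)) : Matrix (Fin n) (Fin n) ℝ :=
  fun i j => if i ∈ D then P i j else 0

section Killed

variable {P : Matrix (Fin n) (Fin n) ℝ} {D : Finset (Fin n)}

theorem killMat_mulVec (v : Fin n → ℝ) (i : Fin n) :
    (killMat P D).mulVec v i = if i ∈ D then P.mulVec v i else 0 := by
  by_cases hi : i ∈ D <;> simp [killMat, Matrix.mulVec, dotProduct, hi]

theorem stopMat_mulVec (v : Fin n → ℝ) (i : Fin n) :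
    (stopMat P D).mulVec v i = if i ∈ D then P.mulVec v i else v i := by
  by_cases hi : i ∈ D <;> simp [stopMat, Matrix.mulVec, dotProduct, hi]

theorem killMat_nonneg (hP : IsStochastic P) (i j : Fin n) : 0 ≤ killMat P D i j := by
  unfold killMat
  split_ifs
  exacts [hP.1 i j, le_rfl]

/-- The mass remaining after `m` steps of the killed chain. -/
def survival (P : Matrix (Fin n) (Fin n) ℝ) (D : Finset (Fin n)) (m : ℕ) : Fin n → ℝ :=
  (killMat P D ^ m).mulVec 1

theorem survival_zero (i : Fin n) : survival P D 0 i = 1 := by simp [survival]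

theorem survival_succ (m : ℕ) :
    survival P D (m + 1) = (killMat P D).mulVec (survival P D m) := by
  rw [survival, survival, Matrix.mulVec_mulVec, pow_succ']

theorem survival_nonneg (hP : IsStochastic P) (m : ℕ) (i : Fin n) : 0 ≤ survival P D m i :=
  mulVec_apply_nonneg (pow_apply_nonneg (killMat_nonneg hP) m) (fun _ => zero_le_one) i

theorem survival_succ_le (hP : IsStochastic P) (m : ℕ) (i : Fin n) :
    survival P D (m + 1) i ≤ survival P D m i := by
  induction m generalizing i with
  | zero =>
    rw [survival_succ, killMat_mulVec, survival_zero]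
    split_ifs
    · simp [Matrix.mulVec, dotProduct, survival_zero, hP.2]
    · exact zero_le_one
  | succ m ih =>
    rw [survival_succ (m + 1)]
    conv_rhs => rw [survival_succ]
    exact mulVec_le_mulVec (killMat_nonneg hP) ih i

theorem survival_antitone (hP : IsStochastic P) (i : Fin n) :
    Antitone fun m => survival P D m i :=
  antitone_nat_of_succ_le fun m => survival_succ_le hP m i

theorem survival_lt_one (hP : IsStochastic P) {y : Fin n} (hy : y ∉ D) (m : ℕ) (x : Fin n)
    (hxy : 0 < (P ^ m) x y) : survival P D (m + 1) x < 1 := by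
  induction m generalizing x with
  | zero =>
    have : x = y := by
      by_contra h0
      simp [h0] at hxy
    rw [survival_succ, killMat_mulVec, if_neg (this ▸ hy)]
    exact zero_lt_one
  | succ m ih =>
    rw [survival_succ, killMat_mulVec]
    split_ifs with hx
    · rw [pow_succ', Matrix.mul_apply] at hxy
      obtain ⟨z, -, hz⟩ := Finset.exists_lt_of_sum_lt (s := Finset.univ) (f := fun _ => (0 : ℝ))
        (by simpa using hxy)
      have hz1 : 0 < P x z := (hP.1 x z).lt_of_ne fun e => by simp [← e] at hz
      have hz2 : 0 < (P ^ m) z y := (pow_apply_nonneg hP.1 m z y).lt_of_ne fun e => by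
        simp [← e] at hz
      rw [← hP.2 x]
      simp only [Matrix.mulVec, dotProduct]
      refine Finset.sum_lt_sum (fun w _ => ?_) ⟨z, Finset.mem_univ z, ?_⟩
      · refine mul_le_of_le_one_right (hP.1 x w) ?_
        rw [← survival_zero (P := P) (D := D) w]
        exact survival_antitone hP w (Nat.zero_le _)
      · exact mul_lt_of_lt_one_right hz1 (ih z hz2)
    · exact zero_lt_one

theorem exists_isContractive_killMat (hP : IsStochastic P) (hirr : IsIrreducible P)
    (hD : D ≠ Finset.univ) : ∃ h, IsContractive (killMat P D) h := by
  obtain ⟨y, hy⟩ : ∃ y, y ∉ D := by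
    by_contra! h0
    exact hD (Finset.eq_univ_iff_forall.2 h0)
  choose m _ hm using fun x => hirr x y
  set N := Finset.univ.sup m + 1 with hN
  have hlt : ∀ x, survival P D N x < 1 := fun x =>
    (survival_antitone hP x (Nat.succ_le_succ (Finset.le_sup (Finset.mem_univ x)))).trans_lt
      (survival_lt_one hP hy (m x) x (hm x))
  refine ⟨∑ j ∈ Finset.range N, survival P D j, killMat_nonneg hP, fun i => ?_, fun i => ?_⟩
  · rw [Finset.sum_apply, hN, Finset.sum_range_succ', survival_zero]
    exact add_pos_of_nonneg_of_pos (Finset.sum_nonneg fun j _ => survival_nonneg hP _ i)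
      zero_lt_one
  · have h1 : (killMat P D).mulVec (∑ j ∈ Finset.range N, survival P D j)
        = ∑ j ∈ Finset.range N, survival P D (j + 1) := by
      simp only [survival_succ, Matrix.mulVec_sum]
    have h2 := Finset.sum_range_succ (fun j => survival P D j i) N
    have h3 := Finset.sum_range_succ' (fun j => survival P D j i) N
    rw [h1, Finset.sum_apply, Finset.sum_apply]
    rw [survival_zero] at h3
    linarith [hlt i]

theorem IsContractive.zeroD_stopMat_pow (hP : IsStochastic P) {h : Fin n → ℝ}
    (hc : IsContractive (killMat P D) h) {τ : ℕ} (hτ : 1 ≤ τ) :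
    IsContractive (zeroD D (stopMat P D ^ τ)) h := by
  have hS := hP.stopMat D
  refine ⟨fun i j => ?_, hc.pos, fun i => ?_⟩
  · unfold zeroD
    split_ifs
    exacts [(hS.pow τ).1 i j, le_rfl]
  set v : Fin n → ℝ := fun x => if x ∈ D then h x else 0 with hv
  have hvh : ∀ x, v x ≤ h x := fun x => by
    simp only [hv]
    split_ifs
    exacts [le_rfl, (hc.pos x).le]
  have hlt : ∀ x ∈ D, (stopMat P D).mulVec v x < v x := fun x hx => by
    have h1 := hc.lt x
    rw [killMat_mulVec, if_pos hx] at h1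
    rw [stopMat_mulVec, if_pos hx]
    refine (mulVec_le_mulVec hP.1 hvh x).trans_lt (h1.trans_eq ?_)
    simp [hv, hx]
  have hle : ∀ x, (stopMat P D).mulVec v x ≤ v x := fun x => by
    by_cases hx : x ∈ D
    · exact (hlt x hx).le
    · rw [stopMat_mulVec, if_neg hx]
  have hpow : ∀ m x, (stopMat P D ^ (m + 1)).mulVec v x ≤ (stopMat P D).mulVec v x := by
    intro m
    induction m with
    | zero => simp
    | succ m ih =>
      intro x
      rw [pow_succ', ← Matrix.mulVec_mulVec]
      exact mulVec_le_mulVec hS.1 (fun y => (ih y).trans (hle y)) x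
  by_cases hi : i ∈ D
  · have h1 : (zeroD D (stopMat P D ^ τ)).mulVec h i = (stopMat P D ^ τ).mulVec v i := by
      simp only [Matrix.mulVec, dotProduct]
      refine Finset.sum_congr rfl fun y _ => ?_
      by_cases hy : y ∈ D <;> simp [zeroD, hv, hi, hy]
    obtain ⟨m, rfl⟩ := Nat.exists_eq_add_of_le' hτ
    rw [h1]
    exact (hpow m i).trans_lt ((hlt i hi).trans_le (hvh i))
  · have h1 : (zeroD D (stopMat P D ^ τ)).mulVec h i = 0 := by
      simp [Matrix.mulVec, dotProduct, zeroD, hi]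
    rw [h1]
    exact hc.pos i

end Killed

/-! ### Markov property -/

/-- The paths which agree with `x` up to time `m`. -/
def cyl (m : ℕ) (x : ℕ → Fin n) : Set (ℕ → Fin n) := {ω | ∀ t ≤ m, ω t = x t}

theorem measurableSet_cyl (m : ℕ) (x : ℕ → Fin n) : MeasurableSet (cyl m x) := by
  have : cyl m x = ⋂ t, ⋂ (_ : t ≤ m), (fun ω : ℕ → Fin n => ω t) ⁻¹' {x t} := by
    ext ω
    simp [cyl]
  rw [this]
  exact MeasurableSet.iInter fun t => MeasurableSet.iInter fun _ =>
    measurable_pi_apply t (MeasurableSet.singleton _)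

/-- The path which follows `p` and is constant afterwards. -/
def pathExt {m : ℕ} (p : Fin (m + 1) → Fin n) : ℕ → Fin n :=
  fun t => p ⟨min t m, by omega⟩

theorem mem_cyl_pathExt {m : ℕ} {p : Fin (m + 1) → Fin n} {ω : ℕ → Fin n} :
    ω ∈ cyl m (pathExt p) ↔ p = fun j : Fin (m + 1) => ω j := by
  constructor
  · intro h
    funext j
    have hj : (j : ℕ) ≤ m := by omega
    rw [h j hj, pathExt]
    congr
    simp [hj]
  · rintro rfl t ht
    simp [pathExt, ht]

theorem eq_sum_cyl {m : ℕ} {F : (ℕ → Fin n) → ℝ} (hF : DependsOn F (Set.Iic m))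
    (ω : ℕ → Fin n) :
    F ω = ∑ p : Fin (m + 1) → Fin n,
      (cyl m (pathExt p)).indicator (fun _ => F (pathExt p)) ω := by
  rw [Finset.sum_eq_single (fun j : Fin (m + 1) => ω j)]
  · have : ω ∈ cyl m (pathExt fun j : Fin (m + 1) => ω j) := mem_cyl_pathExt.2 rfl
    rw [Set.indicator_of_mem this]
    exact hF fun t ht => this t ht
  · intro p _ hp
    exact Set.indicator_of_notMem (fun h => hp (mem_cyl_pathExt.1 h)) _
  · simp

theorem cyl_update (m : ℕ) (x : ℕ → Fin n) (y : Fin n) :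
    cyl (m + 1) (Function.update x (m + 1) y) = cyl m x ∩ {ω | ω (m + 1) = y} := by
  ext ω
  constructor
  · intro h
    refine ⟨fun t ht => ?_, ?_⟩
    · rw [h t (by omega), Function.update_of_ne (by omega)]
    · simpa using h (m + 1) le_rfl
  · rintro ⟨h1, h2⟩ t ht
    rcases Nat.lt_or_ge m t with h | h
    · obtain rfl : t = m + 1 := by omega
      simpa using h2
    · rw [Function.update_of_ne (by omega)]
      exact h1 t h

section Markov

variable {P : Matrix (Fin n) (Fin n) ℝ} {Pr : Fin n → Measure (ℕ → Fin n)}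

theorem IsMarkovFamily.real_cyl (hPr : IsMarkovFamily P Pr) (i : Fin n) (m : ℕ)
    (x : ℕ → Fin n) : (Pr i).real (cyl m x) =
      (if x 0 = i then 1 else 0) * ∏ t ∈ Finset.range m, P (x t) (x (t + 1)) :=
  hPr.2 i m x

theorem IsMarkovFamily.real_cyl_update (hPr : IsMarkovFamily P Pr) (i : Fin n) (m : ℕ)
    (x : ℕ → Fin n) (y : Fin n) :
    (Pr i).real (cyl (m + 1) (Function.update x (m + 1) y)) =
      (Pr i).real (cyl m x) * P (x m) y := by
  have hx : ∀ t ≤ m, Function.update x (m + 1) y t = x t := fun t ht =>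
    Function.update_of_ne (by omega) _ _
  rw [hPr.real_cyl, hPr.real_cyl, Finset.prod_range_succ, mul_assoc, hx 0 (Nat.zero_le _),
    hx m le_rfl, Function.update_self]
  congr 2
  refine Finset.prod_congr rfl fun t ht => ?_
  have := Finset.mem_range.1 ht
  rw [hx t (by omega), hx (t + 1) (by omega)]

theorem IsMarkovFamily.integrable (hPr : IsMarkovFamily P Pr) (i : Fin n) {m : ℕ}
    {F : (ℕ → Fin n) → ℝ} (hF : DependsOn F (Set.Iic m)) : Integrable F (Pr i) := by
  have := hPr.1 i
  rw [funext (eq_sum_cyl hF)]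
  exact integrable_finsetSum _ fun p _ =>
    (integrable_const _).indicator (measurableSet_cyl m _)

theorem IsMarkovFamily.integral_eq_sum (hPr : IsMarkovFamily P Pr) (i : Fin n) {m : ℕ}
    {F : (ℕ → Fin n) → ℝ} (hF : DependsOn F (Set.Iic m)) :
    ∫ ω, F ω ∂(Pr i) =
      ∑ p : Fin (m + 1) → Fin n, (Pr i).real (cyl m (pathExt p)) * F (pathExt p) := by
  have := hPr.1 i
  rw [integral_congr_ae (ae_of_all _ (eq_sum_cyl hF)),
    integral_finsetSum _ fun p _ => (integrable_const _).indicator (measurableSet_cyl m _)]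
  refine Finset.sum_congr rfl fun p _ => ?_
  rw [integral_indicator_const _ (measurableSet_cyl m _), smul_eq_mul]

theorem IsMarkovFamily.integral_mul_next (hPr : IsMarkovFamily P Pr) (i : Fin n) {m : ℕ}
    {F : (ℕ → Fin n) → ℝ} (hF : DependsOn F (Set.Iic m)) (f : Fin n → Fin n → ℝ) :
    ∫ ω, F ω * f (ω m) (ω (m + 1)) ∂(Pr i) =
      ∫ ω, F ω * P.mulVec (f (ω m)) (ω m) ∂(Pr i) := by
  have := hPr.1 i
  have hdep : ∀ g : Fin n → ℝ, DependsOn (fun ω : ℕ → Fin n => F ω * g (ω m)) (Set.Iic m) :=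
    fun g ω ω' h => by
      have h1 := hF h
      have h2 := h m (Set.mem_Iic.2 le_rfl)
      simp only [h1, h2]
  have hsum : ∀ ω, F ω * f (ω m) (ω (m + 1)) = ∑ y, ∑ p : Fin (m + 1) → Fin n,
      (cyl (m + 1) (Function.update (pathExt p) (m + 1) y)).indicator
        (fun _ => F (pathExt p) * f (pathExt p m) y) ω := by
    intro ω
    rw [Finset.sum_eq_single (ω (m + 1))]
    · rw [eq_sum_cyl (hdep fun x => f x (ω (m + 1))) ω]
      refine Finset.sum_congr rfl fun p _ => ?_
      rw [cyl_update]
      by_cases hp : ω ∈ cyl m (pathExt p) <;> simp [hp]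
    · intro y _ hy
      refine Finset.sum_eq_zero fun p _ => Set.indicator_of_notMem ?_ _
      rw [cyl_update]
      exact fun h => hy h.2.symm
    · simp
  have hint : ∀ y, ∀ p : Fin (m + 1) → Fin n, Integrable
      ((cyl (m + 1) (Function.update (pathExt p) (m + 1) y)).indicator
        (fun _ => F (pathExt p) * f (pathExt p m) y)) (Pr i) := fun y p =>
    (integrable_const _).indicator (measurableSet_cyl _ _)
  simp_rw [hsum]
  rw [integral_finsetSum _ fun y _ => integrable_finsetSum _ fun p _ => hint y p,
    hPr.integral_eq_sum i (hdep fun x => P.mulVec (f x) x)]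
  simp_rw [integral_finsetSum _ fun p _ => hint _ p]
  rw [Finset.sum_comm]
  refine Finset.sum_congr rfl fun p _ => ?_
  simp only [Matrix.mulVec, dotProduct, Finset.mul_sum]
  refine Finset.sum_congr rfl fun y _ => ?_
  rw [integral_indicator_const _ (measurableSet_cyl _ _), hPr.real_cyl_update, smul_eq_mul]
  ring

theorem IsMarkovFamily.ae_zero (hPr : IsMarkovFamily P Pr) (i : Fin n) :
    ∀ᵐ ω ∂(Pr i), ω 0 = i := by
  have := hPr.1 i
  have h1 : (Pr i).real (cyl 0 fun _ => i) = 1 := by simp [hPr.real_cyl]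
  rw [measureReal_def, ENNReal.toReal_eq_one_iff,
    ← mem_ae_iff_prob_eq_one (measurableSet_cyl _ _)] at h1
  filter_upwards [h1] with ω hω using hω 0 le_rfl

theorem IsMarkovFamily.integral_zero (hPr : IsMarkovFamily P Pr) (i : Fin n)
    (f : Fin n → ℝ) : ∫ ω, f (ω 0) ∂(Pr i) = f i := by
  have := hPr.1 i
  have h1 : (fun ω : ℕ → Fin n => f (ω 0)) =ᵐ[Pr i] fun _ => f i := by
    filter_upwards [hPr.ae_zero i] with ω hω
    rw [hω]
  rw [integral_congr_ae h1]
  simp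

end Markov

/-! ### The value function -/

section Value

variable {P : Matrix (Fin n) (Fin n) ℝ} {Pr : Fin n → Measure (ℕ → Fin n)}
  {D : Finset (Fin n)} {R : Fin n → ℝ} {h : Fin n → ℝ}

theorem coe_le_exitT_iff {ω : ℕ → Fin n} {t : ℕ} :
    (t : ℕ∞) ≤ exitT D ω ↔ ∀ s < t, ω s ∈ D := by
  simp only [exitT, le_iInf_iff, Nat.cast_le]
  exact ⟨fun H s hs => by_contra fun h0 => (H s h0).not_gt hs,
    fun H s hs => not_lt.1 fun h0 => hs (H s h0)⟩

open Classical in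
/-- The indicator function of the event that the path stays in `D` strictly before time `t`. -/
def alive (D : Finset (Fin n)) (t : ℕ) (ω : ℕ → Fin n) : ℝ := if ∀ s < t, ω s ∈ D then 1 else 0

theorem alive_nonneg (t : ℕ) (ω : ℕ → Fin n) : 0 ≤ alive D t ω := by
  unfold alive
  split_ifs <;> norm_num

theorem alive_succ (t : ℕ) (ω : ℕ → Fin n) :
    alive D (t + 1) ω = alive D t ω * if ω t ∈ D then 1 else 0 := by
  simp only [alive, Nat.lt_succ_iff_lt_or_eq, or_imp, forall_and, forall_eq]
  split_ifs <;> simp_all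

theorem dependsOn_alive (t : ℕ) : DependsOn (alive D t) (Set.Iic t) := fun ω ω' H => by
  have : (∀ s < t, ω s ∈ D) ↔ ∀ s < t, ω' s ∈ D :=
    forall₂_congr fun s hs => by rw [H s hs.le]
  simp only [alive, this]

theorem dependsOn_alive_mul (t : ℕ) (f : Fin n → ℝ) :
    DependsOn (fun ω => alive D t ω * f (ω t)) (Set.Iic t) := fun ω ω' H => by
  have h1 := dependsOn_alive (D := D) t H
  have h2 := H t (Set.mem_Iic.2 le_rfl)
  simp only [h1, h2]

theorem IsMarkovFamily.integral_alive_mul (hPr : IsMarkovFamily P Pr) (i : Fin n) (t : ℕ)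
    (f : Fin n → ℝ) :
    ∫ ω, alive D t ω * f (ω t) ∂(Pr i) = (killMat P D ^ t).mulVec f i := by
  induction t generalizing f with
  | zero => simpa [alive] using hPr.integral_zero i f
  | succ t ih =>
    rw [pow_succ, ← Matrix.mulVec_mulVec, ← ih]
    have hdep : DependsOn (alive D (t + 1)) (Set.Iic t) := fun ω ω' H => by
      have h1 := dependsOn_alive_mul (D := D) t (fun x => if x ∈ D then 1 else 0) H
      simpa only [alive_succ] using h1
    rw [hPr.integral_mul_next i hdep fun _ => f]
    congr 1
    funext ω
    rw [alive_succ, killMat_mulVec]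
    split_ifs <;> simp

theorem IsMarkovFamily.valueE_eq (hPr : IsMarkovFamily P Pr) (hR : ∀ i, 0 ≤ R i) (i : Fin n) :
    valueE Pr D R i = ∑' t : ℕ, ENNReal.ofReal ((killMat P D ^ t).mulVec R i) := by
  refine tsum_congr fun t => ?_
  rw [← hPr.integral_alive_mul, ofReal_integral_eq_lintegral_ofReal
    (hPr.integrable i (dependsOn_alive_mul t R))
    (ae_of_all _ fun ω => mul_nonneg (alive_nonneg t ω) (hR _))]
  congr 1
  funext ω
  by_cases H : ∀ s < t, ω s ∈ D
  · rw [Set.indicator_of_mem (show ω ∈ {ω' | (t : ℕ∞) ≤ exitT D ω'} from coe_le_exitT_iff.2 H)]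
    simp [alive, if_pos H]
  · rw [Set.indicator_of_notMem
      (show ω ∉ {ω' | (t : ℕ∞) ≤ exitT D ω'} from fun h0 => H (coe_le_exitT_iff.1 h0))]
    simp [alive, if_neg H]

theorem IsContractive.summable_pow_mulVec {A : Matrix (Fin n) (Fin n) ℝ} (hc : IsContractive A h)
    (hR : ∀ i, 0 ≤ R i) (i : Fin n) : Summable fun t : ℕ => (A ^ t).mulVec R i := by
  have hG : ∀ j, (1 - A)⁻¹.mulVec R j = R j + A.mulVec ((1 - A)⁻¹.mulVec R) j := fun j => by
    conv_lhs => rw [hc.inv_eq, Matrix.add_mulVec, Matrix.one_mulVec, ← Matrix.mulVec_mulVec]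
    rfl
  have hbound : ∀ T j, ∑ t ∈ Finset.range T, (A ^ t).mulVec R j ≤ (1 - A)⁻¹.mulVec R j := by
    intro T
    induction T with
    | zero => exact fun j => mulVec_apply_nonneg hc.inv_nonneg hR j
    | succ T ih =>
      intro j
      have h1 : ∑ t ∈ Finset.range T, (A ^ (t + 1)).mulVec R j =
          A.mulVec (fun l => ∑ t ∈ Finset.range T, (A ^ t).mulVec R l) j := by
        have h2 : (fun l => ∑ t ∈ Finset.range T, (A ^ t).mulVec R l) =
            ∑ t ∈ Finset.range T, (A ^ t).mulVec R := by
          funext l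
          rw [Finset.sum_apply]
        rw [h2, Matrix.mulVec_sum, Finset.sum_apply]
        simp only [pow_succ', Matrix.mulVec_mulVec]
      rw [Finset.sum_range_succ', h1, hG j, pow_zero, Matrix.one_mulVec, add_comm]
      exact add_le_add_right (mulVec_le_mulVec hc.nonneg ih j) _
  exact summable_of_sum_range_le
    (fun t => mulVec_apply_nonneg (pow_apply_nonneg hc.nonneg t) hR i) (fun T => hbound T i)

theorem valueR_nonneg (i : Fin n) : 0 ≤ valueR Pr D R i := ENNReal.toReal_nonneg

theorem IsMarkovFamily.valueR_eq_tsum (hPr : IsMarkovFamily P Pr)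
    (hc : IsContractive (killMat P D) h) (hR : ∀ i, 0 ≤ R i) (i : Fin n) :
    valueR Pr D R i = ∑' t : ℕ, (killMat P D ^ t).mulVec R i := by
  have h0 : ∀ t : ℕ, 0 ≤ (killMat P D ^ t).mulVec R i := fun t =>
    mulVec_apply_nonneg (pow_apply_nonneg hc.nonneg t) hR i
  rw [valueR, hPr.valueE_eq hR, ← ENNReal.ofReal_tsum_of_nonneg h0 (hc.summable_pow_mulVec hR i),
    ENNReal.toReal_ofReal (tsum_nonneg h0)]

theorem IsMarkovFamily.valueR_eq (hPr : IsMarkovFamily P Pr)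
    (hc : IsContractive (killMat P D) h) (hR : ∀ i, 0 ≤ R i) (i : Fin n) :
    valueR Pr D R i = RD D R i + (stopMat P D).mulVec (valueR Pr D R) i := by
  have hs := hc.summable_pow_mulVec hR
  have h1 : valueR Pr D R i = R i + (killMat P D).mulVec (valueR Pr D R) i := by
    rw [hPr.valueR_eq_tsum hc hR, (hs i).tsum_eq_zero_add, pow_zero, Matrix.one_mulVec]
    congr 1
    have h2 : ∀ t : ℕ, (killMat P D ^ (t + 1)).mulVec R i =
        ∑ j, killMat P D i j * (killMat P D ^ t).mulVec R j := fun t => by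
      rw [pow_succ', ← Matrix.mulVec_mulVec]
      rfl
    simp_rw [h2]
    rw [Summable.tsum_finsetSum fun j _ => (hs j).mul_left _]
    refine Finset.sum_congr rfl fun j _ => ?_
    rw [tsum_mul_left, hPr.valueR_eq_tsum hc hR]
  rw [killMat_mulVec] at h1
  rw [stopMat_mulVec, RD]
  split_ifs with hi
  · rw [if_pos hi] at h1
    exact h1
  · rw [zero_add]

theorem IsMarkovFamily.stopMat_pow_mulVec_valueR_le (hPr : IsMarkovFamily P Pr)
    (hP : IsStochastic P) (hc : IsContractive (killMat P D) h) (hR : ∀ i, 0 ≤ R i) (m : ℕ)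
    (i : Fin n) : (stopMat P D ^ m).mulVec (valueR Pr D R) i ≤ valueR Pr D R i := by
  induction m generalizing i with
  | zero => simp
  | succ m ih =>
    have h1 : 0 ≤ RD D R i := by
      unfold RD
      split_ifs
      exacts [hR i, le_rfl]
    rw [pow_succ', ← Matrix.mulVec_mulVec]
    have h2 := mulVec_le_mulVec (hP.stopMat D).1 ih i
    linarith [hPr.valueR_eq hc hR i]

end Value

/-! ### Second moment of the temporal difference -/

section Variance

variable {P : Matrix (Fin n) (Fin n) ℝ} {Pr : Fin n → Measure (ℕ → Fin n)}
  {D : Finset (Fin n)}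

theorem stopped_eq_of_mem {ω : ℕ → Fin n} {t : ℕ} (ht : stopped D ω t ∈ D) :
    stopped D ω t = ω t := by
  cases t with
  | zero => rfl
  | succ t =>
    simp only [stopped] at ht ⊢
    split_ifs with h1
    · rfl
    · rw [if_neg h1] at ht
      exact absurd ht h1

theorem stopped_congr {ω ω' : ℕ → Fin n} {t : ℕ} (H : ∀ s ≤ t, ω s = ω' s) :
    stopped D ω t = stopped D ω' t := by
  induction t with
  | zero => exact H 0 le_rfl
  | succ t ih => simp only [stopped, ih fun s hs => H s (hs.trans t.le_succ), H (t + 1) le_rfl]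

theorem IsMarkovFamily.integral_mul_stopped_next (hPr : IsMarkovFamily P Pr) (i : Fin n) {m : ℕ}
    {F : (ℕ → Fin n) → ℝ} (hF : DependsOn F (Set.Iic m)) (f : Fin n → Fin n → ℝ) :
    ∫ ω, F ω * f (stopped D ω m) (stopped D ω (m + 1)) ∂(Pr i) =
      ∫ ω, F ω * (stopMat P D).mulVec (f (stopped D ω m)) (stopped D ω m) ∂(Pr i) := by
  set F₁ : (ℕ → Fin n) → ℝ := fun ω => if stopped D ω m ∈ D then F ω else 0 with hF₁
  set F₂ : (ℕ → Fin n) → ℝ := fun ω =>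
    if stopped D ω m ∈ D then 0 else F ω * f (stopped D ω m) (stopped D ω m) with hF₂
  have hd₁ : DependsOn F₁ (Set.Iic m) := fun ω ω' H => by
    simp only [hF₁, hF H, stopped_congr (D := D) (t := m) H]
  have hd₂ : DependsOn F₂ (Set.Iic m) := fun ω ω' H => by
    simp only [hF₂, hF H, stopped_congr (D := D) (t := m) H]
  have hl : ∀ ω, F ω * f (stopped D ω m) (stopped D ω (m + 1)) =
      F₁ ω * f (ω m) (ω (m + 1)) + F₂ ω := fun ω => by
    by_cases h0 : stopped D ω m ∈ D
    · simp only [hF₁, hF₂, stopped, if_pos h0, add_zero]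
      rw [stopped_eq_of_mem h0]
    · simp only [hF₁, hF₂, stopped, if_neg h0, zero_mul, zero_add]
  have hr : ∀ ω, F ω * (stopMat P D).mulVec (f (stopped D ω m)) (stopped D ω m) =
      F₁ ω * P.mulVec (f (ω m)) (ω m) + F₂ ω := fun ω => by
    rw [stopMat_mulVec]
    by_cases h0 : stopped D ω m ∈ D
    · simp only [hF₁, hF₂, if_pos h0, add_zero]
      rw [stopped_eq_of_mem h0]
    · simp only [hF₁, hF₂, if_neg h0, zero_mul, zero_add]
  simp_rw [hl, hr]
  have hi₁ : Integrable (fun ω => F₁ ω * f (ω m) (ω (m + 1))) (Pr i) :=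
    hPr.integrable i (m := m + 1) fun ω ω' H => by
      have h1 := hd₁ fun t ht => H t (Set.mem_Iic.2 ((Set.mem_Iic.1 ht).trans m.le_succ))
      have h2 := H m (Set.mem_Iic.2 m.le_succ)
      have h3 := H (m + 1) (Set.mem_Iic.2 le_rfl)
      simp only [h1, h2, h3]
  have hi₂ : Integrable (fun ω => F₁ ω * P.mulVec (f (ω m)) (ω m)) (Pr i) :=
    hPr.integrable i (m := m) fun ω ω' H => by
      have h1 := hd₁ H
      have h2 := H m (Set.mem_Iic.2 le_rfl)
      simp only [h1, h2]
  rw [integral_add hi₁ (hPr.integrable i hd₂), integral_add hi₂ (hPr.integrable i hd₂),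
    hPr.integral_mul_next i hd₁]

theorem IsMarkovFamily.integral_stopped (hPr : IsMarkovFamily P Pr) (i : Fin n) (t : ℕ)
    (f : Fin n → ℝ) : ∫ ω, f (stopped D ω t) ∂(Pr i) = (stopMat P D ^ t).mulVec f i := by
  induction t generalizing f with
  | zero => simpa [stopped] using hPr.integral_zero i f
  | succ t ih =>
    rw [pow_succ, ← Matrix.mulVec_mulVec, ← ih]
    have := hPr.integral_mul_stopped_next (D := D) i (m := t) (F := fun _ => 1)
      (fun _ _ _ => rfl) fun _ => f
    simpa using this

/-- The variance of `u` under a probability vector is at most its mean square distance to `c`. -/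
theorem IsStochastic.mulVec_sq_le {M : Matrix (Fin n) (Fin n) ℝ} (hM : IsStochastic M)
    {u r : Fin n → ℝ} (hu : ∀ x, u x = r x + M.mulVec u x) (c : ℝ) (x : Fin n) :
    M.mulVec (fun y => (r x + u y - u x) ^ 2) x ≤ M.mulVec (fun y => (u y - c) ^ 2) x := by
  have h1 : ∑ y, M x y * u y = u x - r x := by
    have h2 : u x = r x + ∑ y, M x y * u y := hu x
    linarith
  have h2 : M.mulVec (fun y => (u y - c) ^ 2) x = M.mulVec (fun y => (r x + u y - u x) ^ 2) x
      + (u x - r x - c) ^ 2 := by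
    simp only [Matrix.mulVec, dotProduct]
    have h3 : ∀ y, M x y * (u y - c) ^ 2 = M x y * (r x + u y - u x) ^ 2
        + 2 * (u x - r x - c) * (M x y * u y) + M x y * ((u x - r x - c) ^ 2
          - 2 * (u x - r x - c) * (u x - r x)) := fun y => by ring
    simp_rw [h3]
    rw [Finset.sum_add_distrib, Finset.sum_add_distrib, ← Finset.mul_sum, ← Finset.sum_mul,
      hM.2, h1]
    ring
  rw [h2]
  linarith [sq_nonneg (u x - r x - c)]

theorem IsMarkovFamily.integral_sq_le (hPr : IsMarkovFamily P Pr) (hP : IsStochastic P)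
    {u r : Fin n → ℝ} (hu : ∀ x, u x = r x + (stopMat P D).mulVec u x) (k : Fin n) (m : ℕ) :
    ∫ ω, (∑ t ∈ Finset.range m, r (stopped D ω t) + u (stopped D ω m) - u k) ^ 2 ∂(Pr k) ≤
      ∑ t ∈ Finset.Icc 1 m, ∑ ℓ, (stopMat P D ^ t) k ℓ * (u ℓ - u k) ^ 2 := by
  have := hPr.1 k
  have hS := hP.stopMat D
  induction m with
  | zero =>
    have := hPr.integral_zero k fun x => (u x - u k) ^ 2
    simp [stopped, this]
  | succ m ih =>
    set Z : (ℕ → Fin n) → ℝ := fun ω =>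
      ∑ t ∈ Finset.range m, r (stopped D ω t) + u (stopped D ω m) - u k with hZ
    set δ : Fin n → Fin n → ℝ := fun x y => r x + u y - u x with hδ
    have hZd : DependsOn Z (Set.Iic m) := fun ω ω' H => by
      have h1 : ∀ t ≤ m, stopped D ω t = stopped D ω' t := fun t ht =>
        stopped_congr fun s hs => H s (Set.mem_Iic.2 (hs.trans ht))
      have h2 : ∑ t ∈ Finset.range m, r (stopped D ω t)
          = ∑ t ∈ Finset.range m, r (stopped D ω' t) :=
        Finset.sum_congr rfl fun t ht => by rw [h1 t (Finset.mem_range.1 ht).le]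
      simp only [hZ, h2, h1 m le_rfl]
    have hδd : ∀ (F : (ℕ → Fin n) → ℝ) (g : Fin n → Fin n → ℝ), DependsOn F (Set.Iic m) →
        Integrable (fun ω => F ω * g (stopped D ω m) (stopped D ω (m + 1))) (Pr k) :=
      fun F g hF => hPr.integrable k (m := m + 1) fun ω ω' H => by
        have h1 := hF fun t ht => H t (Set.mem_Iic.2 ((Set.mem_Iic.1 ht).trans m.le_succ))
        have h2 : stopped D ω m = stopped D ω' m :=
          stopped_congr fun s hs => H s (Set.mem_Iic.2 (hs.trans m.le_succ))
        have h3 : stopped D ω (m + 1) = stopped D ω' (m + 1) :=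
          stopped_congr fun s hs => H s (Set.mem_Iic.2 hs)
        simp only [h1, h2, h3]
    have hexp : ∀ ω, (∑ t ∈ Finset.range (m + 1), r (stopped D ω t)
        + u (stopped D ω (m + 1)) - u k) ^ 2 =
        Z ω ^ 2 + (Z ω * (2 * δ (stopped D ω m) (stopped D ω (m + 1)))
          + 1 * δ (stopped D ω m) (stopped D ω (m + 1)) ^ 2) := fun ω => by
      rw [Finset.sum_range_succ]
      simp only [hZ, hδ]
      ring
    have hmean : ∀ x, (stopMat P D).mulVec (fun y => 2 * δ x y) x = 0 := fun x => by
      have h1 : u x = r x + ∑ y, stopMat P D x y * u y := hu x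
      have h2 : ∀ y, stopMat P D x y * (2 * δ x y) = 2 * (r x - u x) * stopMat P D x y
          + 2 * (stopMat P D x y * u y) := fun y => by
        simp only [hδ]
        ring
      simp only [Matrix.mulVec, dotProduct, h2]
      rw [Finset.sum_add_distrib, ← Finset.mul_sum, ← Finset.mul_sum, hS.2]
      linarith
    have hcross : ∫ ω, Z ω * (2 * δ (stopped D ω m) (stopped D ω (m + 1))) ∂(Pr k) = 0 := by
      rw [hPr.integral_mul_stopped_next k hZd fun x y => 2 * δ x y]
      simp [hmean]
    have hsq : ∫ ω, 1 * δ (stopped D ω m) (stopped D ω (m + 1)) ^ 2 ∂(Pr k) ≤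
        ∑ ℓ, (stopMat P D ^ (m + 1)) k ℓ * (u ℓ - u k) ^ 2 := by
      rw [hPr.integral_mul_stopped_next k (F := fun _ => 1) (fun _ _ _ => rfl)
        fun x y => δ x y ^ 2]
      simp only [one_mul]
      rw [hPr.integral_stopped k m fun x => (stopMat P D).mulVec (fun y => δ x y ^ 2) x]
      refine (mulVec_le_mulVec (hS.pow m).1 (fun x => hS.mulVec_sq_le hu (u k) x) k).trans_eq ?_
      rw [Matrix.mulVec_mulVec, ← pow_succ]
      rfl
    have hZ2 : Integrable (fun ω => Z ω ^ 2) (Pr k) :=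
      hPr.integrable k (m := m) fun ω ω' H => by simp only [hZd H]
    have hI₁ := hδd Z (fun x y => 2 * δ x y) hZd
    have hI₂ := hδd (fun _ => 1) (fun x y => δ x y ^ 2) (fun _ _ _ => rfl)
    have hadd := (integral_add hZ2 (hI₁.add hI₂)).trans (congrArg _ (integral_add hI₁ hI₂))
    simp only [Pi.add_apply] at hadd
    rw [Finset.sum_Icc_succ_top (by omega), integral_congr_ae (ae_of_all _ hexp),
      hadd, hcross, zero_add]
    exact add_le_add ih hsq

end Variance

/-! ### Escape probabilities -/

section Escape

variable {M : Matrix (Fin n) (Fin n) ℝ} {Pr : Fin n → Measure (ℕ → Fin n)}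
  {D : Finset (Fin n)}

open Classical in
/-- The indicator function of the event that the path avoids `k`, `ℓ` and the complement of `D`
at the times `1, …, m`. -/
def avoid (D : Finset (Fin n)) (k ℓ : Fin n) (m : ℕ) (ω : ℕ → Fin n) : ℝ :=
  if ∀ t < m, ω (t + 1) ∈ D ∧ ω (t + 1) ≠ k ∧ ω (t + 1) ≠ ℓ then 1 else 0

theorem avoid_nonneg (k ℓ : Fin n) (m : ℕ) (ω : ℕ → Fin n) : 0 ≤ avoid D k ℓ m ω := by
  unfold avoid
  split_ifs <;> norm_num

theorem avoid_succ (k ℓ : Fin n) (m : ℕ) (ω : ℕ → Fin n) :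
    avoid D k ℓ (m + 1) ω = avoid D k ℓ m ω *
      if ω (m + 1) ∈ D ∧ ω (m + 1) ≠ k ∧ ω (m + 1) ≠ ℓ then 1 else 0 := by
  have : (∀ t < m + 1, ω (t + 1) ∈ D ∧ ω (t + 1) ≠ k ∧ ω (t + 1) ≠ ℓ) ↔
      (∀ t < m, ω (t + 1) ∈ D ∧ ω (t + 1) ≠ k ∧ ω (t + 1) ≠ ℓ) ∧
        (ω (m + 1) ∈ D ∧ ω (m + 1) ≠ k ∧ ω (m + 1) ≠ ℓ) := Nat.forall_lt_succ_right
  simp only [avoid, this, ite_and, mul_ite, mul_one, mul_zero]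
  split_ifs <;> rfl

theorem dependsOn_avoid (k ℓ : Fin n) (m : ℕ) : DependsOn (avoid D k ℓ m) (Set.Iic m) :=
  fun ω ω' H => by
    have : (∀ t < m, ω (t + 1) ∈ D ∧ ω (t + 1) ≠ k ∧ ω (t + 1) ≠ ℓ) ↔
        ∀ t < m, ω' (t + 1) ∈ D ∧ ω' (t + 1) ≠ k ∧ ω' (t + 1) ≠ ℓ :=
      forall₂_congr fun t ht => by rw [H (t + 1) (Set.mem_Iic.2 ht)]
    simp only [avoid, this]

theorem integrable_avoid_mul (hPr : IsMarkovFamily M Pr) (i k ℓ : Fin n) (m : ℕ)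
    (f : Fin n → Fin n → ℝ) :
    Integrable (fun ω => avoid D k ℓ m ω * f (ω m) (ω (m + 1))) (Pr i) :=
  hPr.integrable i (m := m + 1) fun ω ω' H => by
    have h1 := dependsOn_avoid (D := D) k ℓ m fun t ht =>
      H t (Set.mem_Iic.2 ((Set.mem_Iic.1 ht).trans m.le_succ))
    have h2 := H m (Set.mem_Iic.2 m.le_succ)
    have h3 := H (m + 1) (Set.mem_Iic.2 le_rfl)
    simp only [h1, h2, h3]

/-- The probability of reaching `ℓ` at time `m + 1` while avoiding `k`, `ℓ` and the complement of
`D` at the times `1, …, m`. -/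
def firstHit (Pr : Fin n → Measure (ℕ → Fin n)) (D : Finset (Fin n)) (k ℓ : Fin n)
    (m : ℕ) : ℝ :=
  ∫ ω, avoid D k ℓ m ω * (if ω (m + 1) = ℓ then 1 else 0) ∂(Pr k)

theorem sum_firstHit_mul_add_le (hPr : IsMarkovFamily M Pr) {k ℓ : Fin n}
    {w : Fin n → ℝ} (hw : ∀ x, 0 ≤ w x)
    (hMw : ∀ x ∈ D, x ≠ k → x ≠ ℓ → M.mulVec w x ≤ w x) (N : ℕ) :
    ∑ m ∈ Finset.range N, firstHit Pr D k ℓ m * w ℓ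
      + ∫ ω, avoid D k ℓ N ω * M.mulVec w (ω N) ∂(Pr k) ≤ M.mulVec w k := by
  induction N with
  | zero =>
    have := hPr.integral_zero k (M.mulVec w)
    simp [avoid, this]
  | succ N ih =>
    refine le_trans ?_ ih
    rw [Finset.sum_range_succ, add_assoc]
    refine add_le_add_right ?_ _
    rw [← hPr.integral_mul_next k (dependsOn_avoid k ℓ N) fun _ => w, firstHit,
      ← integral_mul_const, ← integral_add
        ((integrable_avoid_mul hPr k k ℓ N fun _ y => if y = ℓ then 1 else 0).mul_const _)
        (integrable_avoid_mul hPr k k ℓ (N + 1) fun x _ => M.mulVec w x)]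
    refine integral_mono
      (((integrable_avoid_mul hPr k k ℓ N fun _ y => if y = ℓ then 1 else 0).mul_const _).add
        (integrable_avoid_mul hPr k k ℓ (N + 1) fun x _ => M.mulVec w x))
      (integrable_avoid_mul hPr k k ℓ N fun _ => w) fun ω => ?_
    simp only [avoid_succ, mul_assoc, ← mul_add]
    refine mul_le_mul_of_nonneg_left ?_ (avoid_nonneg k ℓ N ω)
    by_cases h1 : ω (N + 1) = ℓ
    · simp [h1]
    · rw [if_neg h1, zero_mul, zero_add]
      split_ifs with h2
      · rw [one_mul]
        exact hMw _ h2.1 h2.2.1 h2.2.2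
      · rw [zero_mul]
        exact hw _

theorem Qset_subset (k ℓ : Fin n) :
    Qset D k ℓ ⊆ ⋃ m, {ω | (∀ t < m, ω (t + 1) ∈ D ∧ ω (t + 1) ≠ k ∧ ω (t + 1) ≠ ℓ) ∧
      ω (m + 1) = ℓ} := by
  intro ω hω
  have hle : ∀ (A : Set (Fin n)) (s : ℕ), ω (s + 1) ∈ A → hitT A ω ≤ ((s + 1 : ℕ) : ℕ∞) :=
    fun A s hs => by
      unfold hitT
      exact iInf₂_le (s + 1) ⟨s.succ_pos, hs⟩
  have hhit : hitT {ℓ} ω < min (hitT {k} ω) (hitT ((D : Set (Fin n))ᶜ \ {ℓ}) ω) := hω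
  conv_lhs at hhit => unfold hitT
  simp only [iInf_lt_iff] at hhit
  obtain ⟨t, ⟨ht0, htℓ⟩, htlt⟩ := hhit
  obtain ⟨s, rfl⟩ : ∃ s, t = s + 1 := ⟨t - 1, by omega⟩
  have hex : ∃ m, ω (m + 1) = ℓ := ⟨s, htℓ⟩
  classical
  refine Set.mem_iUnion.2 ⟨Nat.find hex, fun r hr => ?_, Nat.find_spec hex⟩
  have hrs : r < s := hr.trans_le (Nat.find_min' hex htℓ)
  have hne : ω (r + 1) ≠ ℓ := Nat.find_min hex hr
  have hlt : ((r + 1 : ℕ) : ℕ∞) < ((s + 1 : ℕ) : ℕ∞) := Nat.cast_lt.2 (Nat.succ_lt_succ hrs)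
  rw [lt_min_iff] at htlt
  refine ⟨?_, ?_, hne⟩
  · by_contra hD
    exact (hle ((D : Set (Fin n))ᶜ \ {ℓ}) r ⟨by simpa using hD, hne⟩).not_gt (hlt.trans htlt.2)
  · intro hk
    exact (hle _ r (Set.mem_singleton_iff.2 hk)).not_gt (hlt.trans htlt.1)

theorem measure_Qset_le (hPr : IsMarkovFamily M Pr) (k ℓ : Fin n) :
    Pr k (Qset D k ℓ) ≤ ∑' m, ENNReal.ofReal (firstHit Pr D k ℓ m) := by
  refine (measure_mono (Qset_subset k ℓ)).trans ((measure_iUnion_le _).trans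
    (ENNReal.tsum_le_tsum fun m => ?_))
  rw [firstHit, ofReal_integral_eq_lintegral_ofReal
    (integrable_avoid_mul hPr k k ℓ m fun _ y => if y = ℓ then 1 else 0)
    (ae_of_all _ fun ω => mul_nonneg (avoid_nonneg k ℓ m ω) (by split_ifs <;> norm_num))]
  have h1 := mul_meas_ge_le_lintegral₀ (integrable_avoid_mul (D := D) hPr k k ℓ m
    fun _ y => if y = ℓ then 1 else 0).aestronglyMeasurable.aemeasurable.ennreal_ofReal 1
  rw [one_mul] at h1
  refine (measure_mono fun ω hω => ?_).trans h1
  simp [avoid, if_pos hω.1, if_pos hω.2]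

theorem IsMarkovFamily.isEscapeBound (hPr : IsMarkovFamily M Pr) (hM : IsStochastic M)
    (k ℓ : Fin n) : IsEscapeBound M D k ℓ (Pr k (Qset D k ℓ)).toReal := by
  intro w hw hMw
  have hMw0 : ∀ x, 0 ≤ M.mulVec w x := mulVec_apply_nonneg hM.1 hw
  rcases (hw ℓ).eq_or_lt with h0 | h0
  · rw [← h0, mul_zero]
    exact hMw0 k
  rw [← le_div_iff₀ h0]
  refine ENNReal.toReal_le_of_le_ofReal (div_nonneg (hMw0 k) h0.le)
    ((measure_Qset_le hPr k ℓ).trans (ENNReal.tsum_le_of_sum_range_le fun N => ?_))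
  have hf : ∀ m, 0 ≤ firstHit Pr D k ℓ m := fun m => integral_nonneg fun ω =>
    mul_nonneg (avoid_nonneg k ℓ m ω) (by split_ifs <;> norm_num)
  rw [← ENNReal.ofReal_sum_of_nonneg fun m _ => hf m]
  refine ENNReal.ofReal_le_ofReal ((le_div_iff₀ h0).2 ?_)
  have h1 := sum_firstHit_mul_add_le (D := D) hPr hw hMw N
  have h2 : 0 ≤ ∫ ω, avoid D k ℓ N ω * M.mulVec w (ω N) ∂(Pr k) :=
    integral_nonneg fun ω => mul_nonneg (avoid_nonneg k ℓ N ω) (hMw0 _)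
  rw [Finset.sum_mul]
  linarith

end Escape

/-! ### The variance bound -/

theorem avar_le {D : Finset (Fin n)} {P : Matrix (Fin n) (Fin n) ℝ} (hP : IsStochastic P)
    {R μ h : Fin n → ℝ} (hR : ∀ i, 0 ≤ R i) (τ : ℕ) (hμ : ∀ i, 0 ≤ μ i)
    {Pr : Fin n → Measure (ℕ → Fin n)} (hPr : IsMarkovFamily P Pr)
    (hc : IsContractive (killMat P D) h) (i : Fin n) :
    avar P Pr D R μ τ i ≤ ∑ k ∈ D, ∑ ℓ ∈ ({k}ᶜ : Finset (Fin n)),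
      (∑ t ∈ Finset.Icc 1 τ, (stopMat P D ^ t) k ℓ) / μ k *
        (green (stopMat P D ^ τ) D i k * |valueR Pr D R ℓ - valueR Pr D R k|) ^ 2 := by
  refine Finset.sum_le_sum fun k _ => ?_
  refine (mul_le_mul_of_nonneg_left (hPr.integral_sq_le hP (hPr.valueR_eq hc hR) k τ)
    (mul_nonneg (inv_nonneg.2 (hμ k)) (sq_nonneg _))).trans_eq ?_
  rw [Finset.sum_comm, ← Finset.sum_subset (Finset.subset_univ ({k}ᶜ : Finset (Fin n)))]
  · rw [Finset.mul_sum]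
    refine Finset.sum_congr rfl fun ℓ _ => ?_
    rw [mul_pow, sq_abs, ← Finset.sum_mul, green]
    ring
  · intro ℓ _ hℓ
    obtain rfl : ℓ = k := by simpa using hℓ
    simp

/-- If `b q ≤ u`, then `b² ≤ u² / q²` in `[0,∞]`, with weights `s / m`. -/
theorem ofReal_div_mul_sq_le {s m b u : ℝ} {q : ℝ≥0∞} (hs : 0 ≤ s) (hm : 0 < m) (hb : 0 ≤ b)
    (hu : 0 ≤ u) (hq : q ≠ ∞) (hbq : b * q.toReal ≤ u) (h0 : 0 < s → u = 0 → b = 0) :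
    ENNReal.ofReal (s / m * b ^ 2) ≤
      ENNReal.ofReal (u ^ 2) * (ENNReal.ofReal s / (ENNReal.ofReal m * q ^ 2)) := by
  rcases hs.eq_or_lt with rfl | hs
  · simp
  rcases hu.eq_or_lt with hu | hu
  · simp [h0 hs hu.symm]
  rcases eq_or_ne q 0 with rfl | hq0
  · have h1 : ENNReal.ofReal s ≠ 0 := (ENNReal.ofReal_pos.2 hs).ne'
    have h2 : ENNReal.ofReal (u ^ 2) ≠ 0 := (ENNReal.ofReal_pos.2 (by positivity)).ne'
    rw [zero_pow two_ne_zero, mul_zero, ENNReal.div_zero h1, ENNReal.mul_top h2]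
    exact le_top
  have hq' : 0 < q.toReal := ENNReal.toReal_pos hq0 hq
  have h1 : q = ENNReal.ofReal q.toReal := (ENNReal.ofReal_toReal hq).symm
  rw [h1, ← ENNReal.ofReal_pow hq'.le, ← ENNReal.ofReal_mul hm.le,
    ← ENNReal.ofReal_div_of_pos (by positivity), ← ENNReal.ofReal_mul (by positivity)]
  refine ENNReal.ofReal_le_ofReal ?_
  have h2 : (b * q.toReal) ^ 2 ≤ u ^ 2 := pow_le_pow_left₀ (by positivity) hbq 2
  calc s / m * b ^ 2 = s / (m * q.toReal ^ 2) * (b * q.toReal) ^ 2 := by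
        field_simp
    _ ≤ s / (m * q.toReal ^ 2) * u ^ 2 := mul_le_mul_of_nonneg_left h2 (by positivity)
    _ = _ := mul_comm _ _

/-- If `u` is superharmonic with `u i = 0`, then `u` vanishes at every point reached from `i`. -/
theorem green_mul_eq_zero {D : Finset (Fin n)} {M N : Matrix (Fin n) (Fin n) ℝ}
    (hM : ∀ i j, 0 ≤ M i j) {h u : Fin n → ℝ} (hc : IsContractive (zeroD D M) h)
    (hu : ∀ x, 0 ≤ u x) (hMu : ∀ x ∈ D, M.mulVec u x ≤ u x) {i k ℓ : Fin n} (hk : k ∈ D)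
    (hN : ∀ i j, 0 ≤ N i j) (hNu : N.mulVec u k ≤ u k) (hkℓ : 0 < N k ℓ) (hi : u i = 0) :
    green M D i k * |u ℓ - u k| = 0 := by
  have h1 := mul_hitProb_le hM hc hu hMu hk i
  have hG := green_nonneg hc i k
  rcases hG.eq_or_lt with h0 | h0
  · rw [← h0, zero_mul]
  have hpos : 0 < hitProb M D k i :=
    div_pos h0 (zero_lt_one.trans_le (one_le_green_self hM hc k))
  have hk0 : u k = 0 := by
    rw [hi] at h1
    exact le_antisymm (nonpos_of_mul_nonpos_left h1 hpos) (hu k)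
  have h2 : N k ℓ * u ℓ ≤ N.mulVec u k := by
    simp only [Matrix.mulVec, dotProduct]
    exact Finset.single_le_sum (f := fun y => N k y * u y)
      (fun y _ => mul_nonneg (hN k y) (hu y)) (Finset.mem_univ ℓ)
  have hℓ0 : u ℓ = 0 :=
    le_antisymm (nonpos_of_mul_nonpos_right (by linarith : N k ℓ * u ℓ ≤ 0) hkℓ) (hu ℓ)
  simp [hk0, hℓ0]

/-- bound (4) of Theorem 1: relative asymptotic variance bound
`σ_i² ≤ u(i)² ∑_{k∈D} ∑_{ℓ≠k} (∑_{t=1}^τ S^t(k,ℓ)) / (μ(k) Q^τ(k,ℓ)²)`, the right-hand side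
being computed in `[0,∞]` (so that `a/0 = ∞` for `a > 0` and `0/0 = 0`). -/
theorem stmt4 {n : ℕ} (hn : 2 ≤ n) (D : Finset (Fin n)) (hD : D.Nonempty)
    (hDne : D ≠ Finset.univ)
    (P : Matrix (Fin n) (Fin n) ℝ) (hP : IsStochastic P) (hirr : IsIrreducible P)
    (R : Fin n → ℝ) (hR : ∀ i, 0 ≤ R i)
    (τ : ℕ) (hτ : 1 ≤ τ)
    (μ : Fin n → ℝ) (hμ0 : ∀ i, 0 ≤ μ i) (hμ1 : ∑ i, μ i = 1)
    (hμsupp : ∀ i ∉ D, μ i = 0) (hμpos : ∀ k ∈ D, 0 < μ k)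
    (Pr : Fin n → Measure (ℕ → Fin n)) (hPr : IsMarkovFamily P Pr)
    -- the law of the `τ`-step chain `Y^τ`, with transition matrix `S^τ`
    (PrY : Fin n → Measure (ℕ → Fin n)) (hPrY : IsMarkovFamily (stopMat P D ^ τ) PrY)
    (i : Fin n) (hi : i ∈ D) :
    ENNReal.ofReal (avar P Pr D R μ τ i)
      ≤ ENNReal.ofReal ((valueR Pr D R i) ^ 2) *
          ∑ k ∈ D, ∑ ℓ ∈ ({k}ᶜ : Finset (Fin n)),
            ENNReal.ofReal (∑ t ∈ Finset.Icc 1 τ, (stopMat P D ^ t) k ℓ) /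
              (ENNReal.ofReal (μ k) * (PrY k (Qset D k ℓ)) ^ 2) := by
  obtain ⟨h, hc⟩ := exists_isContractive_killMat hP hirr hDne
  have hcM := hc.zeroD_stopMat_pow hP hτ
  have hS := hP.stopMat D
  have hM := hS.pow τ
  have hu : ∀ x, 0 ≤ valueR Pr D R x := valueR_nonneg
  have hSu := hPr.stopMat_pow_mulVec_valueR_le hP hc hR
  have hterm : ∀ k ∈ D, ∀ ℓ ∈ ({k}ᶜ : Finset (Fin n)),
      0 ≤ (∑ t ∈ Finset.Icc 1 τ, (stopMat P D ^ t) k ℓ) / μ k *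
        (green (stopMat P D ^ τ) D i k * |valueR Pr D R ℓ - valueR Pr D R k|) ^ 2 :=
    fun k hk ℓ _ => mul_nonneg (div_nonneg (Finset.sum_nonneg fun t _ => (hS.pow t).1 k ℓ)
      (hμ0 k)) (sq_nonneg _)
  refine (ENNReal.ofReal_le_ofReal (avar_le hP hR τ hμ0 hPr hc i)).trans ?_
  rw [ENNReal.ofReal_sum_of_nonneg fun k hk => Finset.sum_nonneg (hterm k hk), Finset.mul_sum]
  refine Finset.sum_le_sum fun k hk => ?_
  rw [ENNReal.ofReal_sum_of_nonneg (hterm k hk), Finset.mul_sum]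
  refine Finset.sum_le_sum fun ℓ _ => ?_
  have := hPrY.1 k
  refine ofReal_div_mul_sq_le (Finset.sum_nonneg fun t _ => (hS.pow t).1 k ℓ) (hμpos k hk)
    (mul_nonneg (green_nonneg hcM i k) (abs_nonneg _)) (hu i) (measure_ne_top _ _) ?_ ?_
  · exact (hPrY.isEscapeBound hM k ℓ).green_mul_le ENNReal.toReal_nonneg hM hcM hu
      (fun x _ => hSu τ x) hk i
  · intro hs hi0
    obtain ⟨t, -, ht⟩ := Finset.exists_lt_of_sum_lt (s := Finset.Icc 1 τ) (f := fun _ => (0 : ℝ))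
      (by simpa using hs)
    exact green_mul_eq_zero hM.1 hcM hu (fun x _ => hSu τ x) hk (hS.pow t).1 (hSu t k) ht hi0

end RareTD
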